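/- Let M be a von Neumann algebra and let {x_α} be a net of n-divisible elements of M converging σ-strong* to x. Then there is a net of n-divisible elements, each of norm at most ‖x‖, converging σ-strong* to x. (Kaplansky-type truncation preserving divisibility.) -/

import Mathlib

open Filter

/-- `x` is `n`-divisible in the von Neumann algebra `M`: the relative commutant
`W*(x)' ∩ M` unitally contains a type `I_n` factor. -/
def NDivisible {H : Type*} [NormedAddCommGroup H] [InnerProductSpace ℂ H] [CompleteSpace H]
    (M : VonNeumannAlgebra H) (n : ℕ) (z : H →L[ℂ] H) : Prop :=
  ∃ φ : Matrix (Fin n) (Fin n) ℂ →⋆ₐ[ℂ] (H →L[ℂ] H),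
    (∀ T, φ T ∈ M) ∧ ∀ T, Commute (φ T) z

/-- σ-strong convergence of a net, via the ℓ²-vector seminorms
`z ↦ (Σ_i ‖z ξ_i‖²)^{1/2}`. -/
def SigmaStrongTendsto {H : Type*} [NormedAddCommGroup H] [InnerProductSpace ℂ H]
    {ι : Type*} (l : Filter ι) (zs : ι → H →L[ℂ] H) (z : H →L[ℂ] H) : Prop :=
  ∀ ξ : ℕ → H, Summable (fun i => ‖ξ i‖ ^ 2) →
    Tendsto (fun α => ∑' i, ‖zs α (ξ i) - z (ξ i)‖ ^ 2) l (nhds 0)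

open Topology

section Truncation

variable {A : Type*} [CStarAlgebra A]

theorem IsSelfAdjoint.exists_polynomial_norm_cfc_sub_lt {f : ℝ → ℝ} {s r ε : ℝ}
    (hf : ContinuousOn f (Set.Icc s r)) (hε : 0 < ε) :
    ∃ p : Polynomial ℝ, ∀ a : A, IsSelfAdjoint a → spectrum ℝ a ⊆ Set.Icc s r →
      ‖cfc f a - Polynomial.aeval a p‖ ≤ ε := by
  obtain ⟨p, hp⟩ := exists_polynomial_near_of_continuousOn s r f hf ε hε
  refine ⟨p, fun a ha hs => ?_⟩
  rw [← cfc_polynomial p a, ← cfc_sub f p.eval a (hf.mono hs)]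
  refine norm_cfc_le hε.le fun t ht => ?_
  rw [Real.norm_eq_abs, abs_sub_comm]
  exact (hp t (hs ht)).le

theorem mul_aeval_eq_aeval_mul {x a b : A} (h : x * a = b * x) (p : Polynomial ℝ) :
    x * Polynomial.aeval a p = Polynomial.aeval b p * x := by
  have hsemi : SemiconjBy x a b := h
  induction p using Polynomial.induction_on' with
  | add p q hp hq => simp [mul_add, add_mul, hp, hq]
  | monomial k r =>
    simp only [Polynomial.aeval_monomial]
    rw [← mul_assoc, ← Algebra.commutes r x, mul_assoc, (hsemi.pow_right k).eq, mul_assoc]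

/-- The continuous functional calculus preserves intertwining relations. -/
theorem mul_cfc_eq_cfc_mul {x a b : A} (ha : IsSelfAdjoint a) (hb : IsSelfAdjoint b)
    (h : x * a = b * x) {f : ℝ → ℝ} (hf : Continuous f) :
    x * cfc f a = cfc f b * x := by
  nontriviality A
  set r := max ‖a‖ ‖b‖
  have hspec {d : A} (hd : ‖d‖ ≤ r) : spectrum ℝ d ⊆ Set.Icc (-r) r := fun t ht =>
    abs_le.mp ((spectrum.norm_le_norm_of_mem ht).trans hd)
  refine eq_of_forall_dist_le fun ε hε => ?_
  have hδ : 0 < ε / (2 * (‖x‖ + 1)) := by positivity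
  obtain ⟨p, hp⟩ := IsSelfAdjoint.exists_polynomial_norm_cfc_sub_lt (A := A)
    (s := -r) (r := r) hf.continuousOn hδ
  have h1 := hp a ha (hspec (le_max_left _ _))
  have h2 := hp b hb (hspec (le_max_right _ _))
  have key : x * cfc f a - cfc f b * x =
      x * (cfc f a - Polynomial.aeval a p) - (cfc f b - Polynomial.aeval b p) * x := by
    rw [mul_sub, sub_mul, mul_aeval_eq_aeval_mul h]
    abel
  rw [dist_eq_norm, key]
  calc _ ≤ ‖x‖ * ‖cfc f a - Polynomial.aeval a p‖ + ‖cfc f b - Polynomial.aeval b p‖ * ‖x‖ :=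
        norm_sub_le_of_le (norm_mul_le _ _) (norm_mul_le _ _)
    _ ≤ ‖x‖ * (ε / (2 * (‖x‖ + 1))) + ε / (2 * (‖x‖ + 1)) * ‖x‖ := by gcongr
    _ ≤ ε := by
      have hx := norm_nonneg x
      rw [← sub_nonneg]
      have : ε - (‖x‖ * (ε / (2 * (‖x‖ + 1))) + ε / (2 * (‖x‖ + 1)) * ‖x‖) =
          ε / (‖x‖ + 1) := by
        field_simp
        ring
      rw [this]
      positivity

/-- The scalar factor of the radial truncation at height `c`. -/
noncomputable def truncFactor (c s : ℝ) : ℝ := c / √(max s (c ^ 2))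

theorem continuous_truncFactor {c : ℝ} (hc : 0 < c) : Continuous (truncFactor c) := by
  have (s : ℝ) : √(max s (c ^ 2)) ≠ 0 := by positivity
  unfold truncFactor
  fun_prop (disch := exact this _)

theorem truncFactor_of_le {c s : ℝ} (hc : 0 < c) (hs : s ≤ c ^ 2) : truncFactor c s = 1 := by
  rw [truncFactor, max_eq_right hs, Real.sqrt_sq hc.le, div_self hc.ne']

theorem truncFactor_sq_mul_le {c s : ℝ} (hc : 0 < c) :
    truncFactor c s * s * truncFactor c s ≤ c ^ 2 := by
  have hm : 0 < max s (c ^ 2) := by positivity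
  have : truncFactor c s * s * truncFactor c s = c ^ 2 * (s / max s (c ^ 2)) := by
    rw [truncFactor]
    field_simp
    rw [Real.sq_sqrt hm.le, mul_comm]
  rw [this]
  exact mul_le_of_le_one_right (sq_nonneg c) ((div_le_one hm).2 (le_max_left _ _))

theorem exists_continuous_comp_inv_eq_truncFactor {c : ℝ} (hc : 0 < c) :
    ∃ g : ℝ → ℝ, Continuous g ∧ ∀ s, 0 ≤ s → g (1 + s)⁻¹ = truncFactor c s := by
  have hpos (t : ℝ) : 0 < max (1 - t) (c ^ 2 * t) := by
    rcases lt_or_ge t 1 with h | h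
    · exact lt_max_of_lt_left (by linarith)
    · exact lt_max_of_lt_right (by positivity)
  refine ⟨fun t => c * √t / √(max (1 - t) (c ^ 2 * t)), ?_, fun s hs => ?_⟩
  · have (t : ℝ) : √(max (1 - t) (c ^ 2 * t)) ≠ 0 := (Real.sqrt_pos.2 (hpos t)).ne'
    fun_prop (disch := exact this _)
  · have ht : 0 < (1 + s)⁻¹ := by positivity
    have : max (1 - (1 + s)⁻¹) (c ^ 2 * (1 + s)⁻¹) = max s (c ^ 2) * (1 + s)⁻¹ := by
      rw [max_mul_of_nonneg _ _ ht.le]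
      congr 1
      field_simp
      ring
    simp only [this, truncFactor]
    rw [Real.sqrt_mul (by positivity), mul_div_mul_right _ _ (Real.sqrt_pos.2 ht).ne']

/-- The radial truncation `x ↦ x · min(1, c / |x|)`. -/
noncomputable def radialTrunc (c : ℝ) (x : A) : A := x * cfc (truncFactor c) (star x * x)

theorem radialTrunc_eq_cfc_mul {c : ℝ} (hc : 0 < c) (x : A) :
    radialTrunc c x = cfc (truncFactor c) (x * star x) * x :=
  mul_cfc_eq_cfc_mul (.star_mul_self x) (.mul_star_self x) (mul_assoc x _ x).symm
    (continuous_truncFactor hc)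

theorem star_radialTrunc {c : ℝ} (hc : 0 < c) (x : A) :
    star (radialTrunc c x) = radialTrunc c (star x) := by
  rw [radialTrunc_eq_cfc_mul hc, radialTrunc, star_mul, star_star,
    (cfc_predicate (R := ℝ) (p := IsSelfAdjoint) (truncFactor c) (x * star x)).star_eq]

theorem norm_mul_cfc_star_mul_self_le {x : A} {f : ℝ → ℝ} {c : ℝ} (hc : 0 ≤ c)
    (hf : ContinuousOn f (spectrum ℝ (star x * x)))
    (h : ∀ s ∈ spectrum ℝ (star x * x), |f s * s * f s| ≤ c ^ 2) :
    ‖x * cfc f (star x * x)‖ ≤ c := by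
  have hsa : IsSelfAdjoint (cfc f (star x * x)) := cfc_predicate f (star x * x)
  have key : star (x * cfc f (star x * x)) * (x * cfc f (star x * x)) =
      cfc (fun s => f s * s * f s) (star x * x) := by
    rw [cfc_mul (fun s => f s * s) f (star x * x) (hf.mul continuousOn_id),
      cfc_mul f (fun s => s) (star x * x), cfc_id' ℝ (star x * x) (.star_mul_self x), star_mul,
      hsa.star_eq]
    simp only [mul_assoc]
  refine abs_le_of_sq_le_sq' ?_ hc |>.2
  rw [sq, ← CStarRing.norm_star_mul_self, key]
  exact norm_cfc_le (sq_nonneg c) h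

theorem norm_le_of_mem_spectrum_star_mul_self {x : A} {s : ℝ}
    (hs : s ∈ spectrum ℝ (star x * x)) : s ≤ ‖x‖ ^ 2 := by
  have : Nontrivial A := not_subsingleton_iff_nontrivial.1 fun _ => by
    simp [spectrum.of_subsingleton] at hs
  rw [sq, ← CStarRing.norm_star_mul_self]
  exact (le_abs_self s).trans (spectrum.norm_le_norm_of_mem hs)

theorem radialTrunc_norm_self {x : A} (hx : 0 < ‖x‖) : radialTrunc ‖x‖ x = x := by
  rw [radialTrunc, cfc_congr (g := fun _ => 1) fun s hs =>
    truncFactor_of_le hx (norm_le_of_mem_spectrum_star_mul_self hs),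
    cfc_const_one ℝ (star x * x) (.star_mul_self x), mul_one]

theorem Commute.radialTrunc_right {x b : A} (c : ℝ) (h : Commute b x) (h' : Commute b (star x)) :
    Commute b (radialTrunc c x) :=
  h.mul_right ((h'.mul_right h).symm.cfc_real (truncFactor c)).symm

theorem norm_radialTrunc_le {c : ℝ} (hc : 0 < c) (x : A) : ‖radialTrunc c x‖ ≤ c := by
  refine norm_mul_cfc_star_mul_self_le hc.le (continuous_truncFactor hc).continuousOn
    fun s hs => ?_
  have hs0 : 0 ≤ s := spectrum_star_mul_self_nonneg s hs
  rw [abs_of_nonneg]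
  · exact truncFactor_sq_mul_le hc
  · rw [mul_right_comm]
    exact mul_nonneg (mul_self_nonneg _) hs0

theorem continuousOn_one_add_inv_spectrum (x : A) :
    ContinuousOn (fun s : ℝ => (1 + s)⁻¹) (spectrum ℝ (star x * x)) := by
  refine ContinuousOn.inv₀ (by fun_prop) fun s hs => ?_
  have hs0 : 0 ≤ s := spectrum_star_mul_self_nonneg s hs
  positivity

/-- The resolvent `(1 + x⋆x)⁻¹`. -/
noncomputable def oneAddInv (x : A) : A := cfc (fun s : ℝ => (1 + s)⁻¹) (star x * x)

theorem isSelfAdjoint_oneAddInv (x : A) : IsSelfAdjoint (oneAddInv x) := cfc_predicate _ _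

theorem oneAddInv_mul (x : A) : oneAddInv x * (1 + star x * x) = 1 := by
  have hsa : IsSelfAdjoint (star x * x) := .star_mul_self x
  have h1 : (1 + star x * x) = cfc (fun s : ℝ => 1 + s) (star x * x) := by
    rw [cfc_const_add 1 (fun s => s) (star x * x), cfc_id' ℝ (star x * x), map_one]
  rw [h1, oneAddInv, ← cfc_mul _ _ _ (continuousOn_one_add_inv_spectrum x),
    ← cfc_const_one ℝ (star x * x)]
  refine cfc_congr fun s hs => inv_mul_cancel₀ ?_
  have hs0 : 0 ≤ s := spectrum_star_mul_self_nonneg s hs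
  positivity

theorem mul_oneAddInv (x : A) : (1 + star x * x) * oneAddInv x = 1 := by
  have := congr_arg star (oneAddInv_mul x)
  simpa [(isSelfAdjoint_oneAddInv x).star_eq] using this

theorem spectrum_oneAddInv_subset (x : A) : spectrum ℝ (oneAddInv x) ⊆ Set.Icc 0 1 := by
  rw [oneAddInv, cfc_map_spectrum _ _ (.star_mul_self x) (continuousOn_one_add_inv_spectrum x)]
  rintro _ ⟨s, hs, rfl⟩
  have hs0 : 0 ≤ s := spectrum_star_mul_self_nonneg s hs
  exact ⟨by positivity, inv_le_one_of_one_le₀ (by linarith)⟩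

theorem norm_oneAddInv_le (x : A) : ‖oneAddInv x‖ ≤ 1 := by
  refine norm_cfc_le zero_le_one fun s hs => ?_
  have hs0 : 0 ≤ s := spectrum_star_mul_self_nonneg s hs
  rw [Real.norm_of_nonneg (by positivity)]
  exact inv_le_one_of_one_le₀ (by linarith)

theorem norm_oneAddInv_mul_star_le (x : A) : ‖oneAddInv x * star x‖ ≤ 1 := by
  have h : star (oneAddInv x * star x) = x * oneAddInv x := by
    rw [star_mul, star_star, (isSelfAdjoint_oneAddInv x).star_eq]
  rw [← norm_star, h]
  refine norm_mul_cfc_star_mul_self_le zero_le_one (continuousOn_one_add_inv_spectrum x)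
    fun s hs => ?_
  have hs0 : 0 ≤ s := spectrum_star_mul_self_nonneg s hs
  rw [abs_of_nonneg (by positivity), one_pow, inv_mul_eq_div, ← div_eq_mul_inv,
    div_div, div_le_one (by positivity)]
  nlinarith

theorem cfc_oneAddInv {f g : ℝ → ℝ} (hg : Continuous g) (hfg : ∀ s, 0 ≤ s → g (1 + s)⁻¹ = f s)
    (x : A) : cfc g (oneAddInv x) = cfc f (star x * x) := by
  rw [oneAddInv, ← cfc_comp' g _ _ hg.continuousOn (continuousOn_one_add_inv_spectrum x)
    (.star_mul_self x)]
  exact cfc_congr fun s hs => hfg s (spectrum_star_mul_self_nonneg s hs)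

theorem oneAddInv_sub_oneAddInv (x y : A) :
    oneAddInv y - oneAddInv x =
      -(oneAddInv y * star y * (y - x) * oneAddInv x) -
        oneAddInv y * (star y - star x) * x * oneAddInv x := by
  calc oneAddInv y - oneAddInv x
      = oneAddInv y * ((1 + star x * x) * oneAddInv x) -
        oneAddInv y * (1 + star y * y) * oneAddInv x := by
        rw [mul_oneAddInv, oneAddInv_mul, mul_one, one_mul]
    _ = _ := by noncomm_ring

end Truncation

section StrongConvergence

variable {H : Type*} [NormedAddCommGroup H] [InnerProductSpace ℂ H]
  {ι : Type*} {l : Filter ι}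

theorem tendsto_apply_zero_of_norm_le {B : ι → H →L[ℂ] H} {v : ι → H} {K : ℝ}
    (hB : ∀ α, ‖B α‖ ≤ K) (hv : Tendsto v l (𝓝 0)) :
    Tendsto (fun α => B α (v α)) l (𝓝 0) := by
  refine squeeze_zero_norm (a := fun α => K * ‖v α‖) (fun α => ?_) ?_
  · exact (B α).le_of_opNorm_le (hB α) _
  · simpa using hv.norm.const_mul K

theorem tendsto_apply_of_norm_le {B : ι → H →L[ℂ] H} {B₀ : H →L[ℂ] H} {v : ι → H} {v₀ : H} {K : ℝ}
    (hB : ∀ α, ‖B α‖ ≤ K) (hB₀ : ∀ ξ, Tendsto (fun α => B α ξ) l (𝓝 (B₀ ξ)))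
    (hv : Tendsto v l (𝓝 v₀)) :
    Tendsto (fun α => B α (v α)) l (𝓝 (B₀ v₀)) := by
  have h := (tendsto_apply_zero_of_norm_le hB (tendsto_sub_nhds_zero_iff.2 hv)).add (hB₀ v₀)
  simpa using h

theorem tendsto_aeval_apply {B : ι → H →L[ℂ] H} {B₀ : H →L[ℂ] H} {K : ℝ}
    (hB : ∀ α, ‖B α‖ ≤ K) (hB₀ : ∀ ξ, Tendsto (fun α => B α ξ) l (𝓝 (B₀ ξ)))
    (p : Polynomial ℝ) (ξ : H) :
    Tendsto (fun α => Polynomial.aeval (B α) p ξ) l (𝓝 (Polynomial.aeval B₀ p ξ)) := by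
  have hpow (k : ℕ) : Tendsto (fun α => (B α ^ k) ξ) l (𝓝 ((B₀ ^ k) ξ)) := by
    induction k with
    | zero => simpa using tendsto_const_nhds
    | succ k ih =>
      simp only [pow_succ', mul_apply_eq_comp]
      exact tendsto_apply_of_norm_le hB hB₀ ih
  induction p using Polynomial.induction_on' with
  | add p q hp hq => simpa using hp.add hq
  | monomial k r =>
    simp only [Polynomial.aeval_monomial, ← Algebra.smul_def]
    exact (hpow k).const_smul r

theorem SigmaStrongTendsto.tendsto_apply {zs : ι → H →L[ℂ] H} {z : H →L[ℂ] H}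
    (h : SigmaStrongTendsto l zs z) (ξ : H) : Tendsto (fun α => zs α ξ) l (𝓝 (z ξ)) := by
  have hsum : Summable fun i => ‖(Pi.single 0 ξ : ℕ → H) i‖ ^ 2 :=
    summable_of_ne_finset_zero (s := {0}) fun i hi => by
      simp [Pi.single_eq_of_ne (Finset.notMem_singleton.1 hi)]
  have h1 := h _ hsum
  have h2 (α : ι) : ∑' i, ‖zs α ((Pi.single 0 ξ : ℕ → H) i) - z ((Pi.single 0 ξ : ℕ → H) i)‖ ^ 2 =
      ‖zs α ξ - z ξ‖ ^ 2 := by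
    rw [tsum_eq_single 0 fun i hi => by simp [Pi.single_eq_of_ne hi], Pi.single_eq_same]
  simp only [h2] at h1
  rw [tendsto_iff_norm_sub_tendsto_zero]
  simpa [Real.sqrt_sq] using h1.sqrt

theorem sigmaStrongTendsto_of_norm_le {zs : ι → H →L[ℂ] H} {z : H →L[ℂ] H} {K : ℝ}
    (hK : ∀ α, ‖zs α‖ ≤ K) (hz : ‖z‖ ≤ K) (h : ∀ ξ, Tendsto (fun α => zs α ξ) l (𝓝 (z ξ))) :
    SigmaStrongTendsto l zs z := by
  intro ξ hξ
  have key : Tendsto (fun α => ∑' i, ‖zs α (ξ i) - z (ξ i)‖ ^ 2) l (𝓝 (∑' _ : ℕ, (0 : ℝ))) := by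
    refine tendsto_tsum_of_dominated_convergence (hξ.mul_left ((K + K) ^ 2)) (fun i => ?_)
      (.of_forall fun α i => ?_)
    · simpa using (tendsto_iff_norm_sub_tendsto_zero.1 (h (ξ i))).pow 2
    · rw [Real.norm_of_nonneg (sq_nonneg _), ← mul_pow, add_mul]
      gcongr
      exact norm_sub_le_of_le ((zs α).le_of_opNorm_le (hK α) _) (z.le_of_opNorm_le hz _)
  simpa using key

variable [CompleteSpace H]

theorem tendsto_cfc_apply {B : ι → H →L[ℂ] H} {B₀ : H →L[ℂ] H} {a b K : ℝ}
    (hK : ∀ α, ‖B α‖ ≤ K) (hB : ∀ α, IsSelfAdjoint (B α)) (hB₀ : IsSelfAdjoint B₀)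
    (hs : ∀ α, spectrum ℝ (B α) ⊆ Set.Icc a b) (hs₀ : spectrum ℝ B₀ ⊆ Set.Icc a b)
    (h : ∀ ξ, Tendsto (fun α => B α ξ) l (𝓝 (B₀ ξ)))
    {f : ℝ → ℝ} (hf : ContinuousOn f (Set.Icc a b)) (ξ : H) :
    Tendsto (fun α => cfc f (B α) ξ) l (𝓝 (cfc f B₀ ξ)) := by
  rw [Metric.tendsto_nhds]
  intro ε hε
  have hδ : 0 < ε / (3 * (‖ξ‖ + 1)) := by positivity
  obtain ⟨p, hp⟩ := IsSelfAdjoint.exists_polynomial_norm_cfc_sub_lt (A := H →L[ℂ] H) hf hδ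
  have hle {D : H →L[ℂ] H} (hD : IsSelfAdjoint D) (hsD : spectrum ℝ D ⊆ Set.Icc a b) :
      dist (cfc f D ξ) (Polynomial.aeval D p ξ) < ε / 3 := by
    rw [dist_eq_norm, ← sub_apply]
    calc _ ≤ ε / (3 * (‖ξ‖ + 1)) * ‖ξ‖ := ContinuousLinearMap.le_of_opNorm_le _ (hp D hD hsD) _
      _ < ε / (3 * (‖ξ‖ + 1)) * (‖ξ‖ + 1) := by gcongr; linarith
      _ = ε / 3 := by field_simp
  filter_upwards [Metric.tendsto_nhds.1 (tendsto_aeval_apply hK h p ξ) (ε / 3) (by positivity)]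
    with α hα
  have h1 := hle (hB α) (hs α)
  have h2 := hle hB₀ hs₀
  rw [dist_comm] at h2
  linarith [dist_triangle4 (cfc f (B α) ξ) (Polynomial.aeval (B α) p ξ)
    (Polynomial.aeval B₀ p ξ) (cfc f B₀ ξ)]

theorem tendsto_oneAddInv_apply {zs : ι → H →L[ℂ] H} {z : H →L[ℂ] H}
    (h : ∀ ξ, Tendsto (fun α => zs α ξ) l (𝓝 (z ξ)))
    (hstar : ∀ ξ, Tendsto (fun α => star (zs α) ξ) l (𝓝 (star z ξ))) (ξ : H) :
    Tendsto (fun α => oneAddInv (zs α) ξ) l (𝓝 (oneAddInv z ξ)) := by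
  rw [← tendsto_sub_nhds_zero_iff]
  have h1 := tendsto_apply_zero_of_norm_le (fun α => norm_oneAddInv_mul_star_le (zs α))
    (tendsto_sub_nhds_zero_iff.2 (h (oneAddInv z ξ)))
  have h2 := tendsto_apply_zero_of_norm_le (fun α => norm_oneAddInv_le (zs α))
    (tendsto_sub_nhds_zero_iff.2 (hstar (z (oneAddInv z ξ))))
  have h3 := h1.neg.sub h2
  rw [neg_zero, sub_zero] at h3
  refine h3.congr fun α => ?_
  rw [← sub_apply (oneAddInv (zs α)), oneAddInv_sub_oneAddInv]
  rfl

/-- Radial truncation is strong-* to strong continuous, also along unbounded nets. -/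
theorem tendsto_radialTrunc_apply {c : ℝ} (hc : 0 < c) {zs : ι → H →L[ℂ] H} {z : H →L[ℂ] H}
    (h : ∀ ξ, Tendsto (fun α => zs α ξ) l (𝓝 (z ξ)))
    (hstar : ∀ ξ, Tendsto (fun α => star (zs α) ξ) l (𝓝 (star z ξ))) (ξ : H) :
    Tendsto (fun α => radialTrunc c (zs α) ξ) l (𝓝 (radialTrunc c z ξ)) := by
  obtain ⟨g, hg, hgf⟩ := exists_continuous_comp_inv_eq_truncFactor hc
  have heq (y : H →L[ℂ] H) : radialTrunc c y = cfc g (oneAddInv (star y)) * y := by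
    rw [radialTrunc_eq_cfc_mul hc, cfc_oneAddInv hg hgf, star_star]
  obtain ⟨K, hK⟩ := isCompact_Icc.exists_bound_of_continuousOn
    (hg.continuousOn (s := Set.Icc 0 1))
  have hK0 : 0 ≤ K := (norm_nonneg _).trans (hK 0 (by simp))
  have hbound (α : ι) : ‖cfc g (oneAddInv (star (zs α)))‖ ≤ K :=
    norm_cfc_le hK0 fun t ht => hK t (spectrum_oneAddInv_subset _ ht)
  have hres : ∀ η, Tendsto (fun α => oneAddInv (star (zs α)) η) l (𝓝 (oneAddInv (star z) η)) :=
    tendsto_oneAddInv_apply hstar (by simpa only [star_star] using h)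
  have hcfc (η : H) : Tendsto (fun α => cfc g (oneAddInv (star (zs α))) η) l
      (𝓝 (cfc g (oneAddInv (star z)) η)) :=
    tendsto_cfc_apply (fun α => norm_oneAddInv_le (star (zs α)))
      (fun α => isSelfAdjoint_oneAddInv (star (zs α))) (isSelfAdjoint_oneAddInv (star z))
      (fun α => spectrum_oneAddInv_subset (star (zs α))) (spectrum_oneAddInv_subset (star z))
      hres hg.continuousOn η
  simp only [heq, mul_apply_eq_comp]
  exact tendsto_apply_of_norm_le hbound hcfc (h ξ)

end StrongConvergence

section VonNeumann

variable {H : Type*} [NormedAddCommGroup H] [InnerProductSpace ℂ H] [CompleteSpace H]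
  {M : VonNeumannAlgebra H} {n : ℕ} {z : H →L[ℂ] H}

theorem VonNeumannAlgebra.radialTrunc_mem (c : ℝ) (hz : z ∈ M) : radialTrunc c z ∈ M := by
  rw [← M.commutant_commutant, VonNeumannAlgebra.mem_commutant_iff]
  intro b hb
  rw [VonNeumannAlgebra.mem_commutant_iff] at hb
  exact Commute.radialTrunc_right c (hb z hz).symm (hb (star z) (star_mem hz)).symm

theorem NDivisible.radialTrunc (c : ℝ) (hz : NDivisible M n z) :
    NDivisible M n (radialTrunc c z) := by
  obtain ⟨φ, hφM, hφ⟩ := hz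
  refine ⟨φ, hφM, fun T => Commute.radialTrunc_right c (hφ T) ?_⟩
  have h := (hφ (star T)).star_star
  rwa [map_star, star_star] at h

theorem NDivisible.zero (hz : NDivisible M n z) : NDivisible M n 0 :=
  let ⟨φ, hφM, _⟩ := hz
  ⟨φ, hφM, fun _ => Commute.zero_right _⟩

end VonNeumann

/-- Kaplansky-type truncation preserving divisibility: if a net of
`n`-divisible elements of `M` converges σ-strong* to `x ∈ M`, then there is a net of
`n`-divisible elements of `M`, each of norm at most `‖x‖`, converging σ-strong* to `x`. -/
theorem stmt17 {H : Type*} [NormedAddCommGroup H] [InnerProductSpace ℂ H] [CompleteSpace H]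
    (M : VonNeumannAlgebra H) (n : ℕ) (hn : 2 ≤ n)
    (x : H →L[ℂ] H) (hx : x ∈ M)
    {ι : Type*} (l : Filter ι) (hl : l.NeBot)
    (xs : ι → H →L[ℂ] H) (hmem : ∀ α, xs α ∈ M)
    (hdiv : ∀ α, NDivisible M n (xs α))
    (hconv : SigmaStrongTendsto l xs x)
    (hconvs : SigmaStrongTendsto l (fun α => star (xs α)) (star x)) :
    ∃ ys : ι → H →L[ℂ] H, (∀ α, ys α ∈ M) ∧ (∀ α, NDivisible M n (ys α)) ∧
      (∀ α, ‖ys α‖ ≤ ‖x‖) ∧ SigmaStrongTendsto l ys x ∧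
      SigmaStrongTendsto l (fun α => star (ys α)) (star x) := by
  rcases (norm_nonneg x).eq_or_lt with h0 | hpos
  · obtain rfl : x = 0 := norm_eq_zero.1 h0.symm
    refine ⟨fun _ => 0, fun _ => zero_mem M, fun α => (hdiv α).zero, fun _ => le_rfl, ?_, ?_⟩ <;>
      exact fun ξ _ => by simp
  · have h := hconv.tendsto_apply
    have hstar := hconvs.tendsto_apply
    have hnorm (y : H →L[ℂ] H) : ‖radialTrunc ‖x‖ y‖ ≤ ‖x‖ := norm_radialTrunc_le hpos y
    refine ⟨fun α => radialTrunc ‖x‖ (xs α), fun α => M.radialTrunc_mem _ (hmem α),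
      fun α => (hdiv α).radialTrunc _, fun α => hnorm _, ?_, ?_⟩
    · refine sigmaStrongTendsto_of_norm_le (fun α => hnorm _) le_rfl fun ξ => ?_
      simpa only [radialTrunc_norm_self hpos] using tendsto_radialTrunc_apply hpos h hstar ξ
    · simp only [star_radialTrunc hpos]
      refine sigmaStrongTendsto_of_norm_le (fun α => hnorm _) (norm_star x).le fun ξ => ?_
      have key := tendsto_radialTrunc_apply hpos hstar (z := star x) (by simpa using h) ξ
      rwa [← star_radialTrunc hpos, radialTrunc_norm_self hpos] at key
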